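/- arXiv:1605.03151 — 8 statements merged into one kernel-verified Lean document; each statement's English description precedes it below -/
import Mathlib

section
/- Let G be a 2-tree (a graph obtained from the triangle K_3 by repeatedly adding a new vertex adjacent to both endpoints of an existing edge). Then G contains no split independent set; that is, there is no independent set S of vertices of G such that the subgraph induced by V∖S is disconnected or consists of a single vertex. -/
open SimpleGraph

namespace SplitDomination

variable {V : Type*}

/-- `S` is an independent set of `G`. -/
def Indep (G : SimpleGraph V) (S : Set V) : Prop :=
  ∀ ⦃u⦄, u ∈ S → ∀ ⦃v⦄, v ∈ S → ¬ G.Adj u v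

/-- `S` is a dominating set of `G`. -/
def Dominating (G : SimpleGraph V) (S : Set V) : Prop :=
  ∀ v ∉ S, ∃ u ∈ S, G.Adj u v

/-- The closed neighborhood `N[S]` of a set `S`. -/
def ClosedNbhd (G : SimpleGraph V) (S : Set V) : Set V :=
  {w | w ∈ S ∨ ∃ u ∈ S, G.Adj u w}

/-- `u` has a private neighbor with respect to `S`:
a vertex `w ∈ N[u]` with `w ∉ N[S \ {u}]`. -/
def HasPrivateNbr (G : SimpleGraph V) (S : Set V) (u : V) : Prop :=
  ∃ w, (w = u ∨ G.Adj u w) ∧ w ∉ ClosedNbhd G (S \ {u})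

/-- The induced subgraph `⟨T⟩` is disconnected or consists of a single vertex. -/
def DisconnOrK1 (G : SimpleGraph V) (T : Set V) : Prop :=
  ¬ (G.induce T).Connected ∨ T.ncard = 1

/-- `G` has no isolated vertices. -/
def NoIsolated (G : SimpleGraph V) : Prop :=
  ∀ v : V, ∃ u, G.Adj u v

/-- `S` is a split dominating set: dominating, and `⟨V ∖ S⟩` is disconnected or a `K₁`. -/
def SplitDominating (G : SimpleGraph V) (S : Set V) : Prop :=
  Dominating G S ∧ DisconnOrK1 G Sᶜ

/-- `S` is a minimal split dominating set. -/
def MinimalSplitDominating (G : SimpleGraph V) (S : Set V) : Prop :=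
  SplitDominating G S ∧
    ∀ u ∈ S, HasPrivateNbr G S u ∨ (G.induce (Sᶜ ∪ {u})).Connected

/-- `S` is a split independent set: independent, and `⟨V ∖ S⟩` is disconnected or a `K₁`. -/
def SplitIndep (G : SimpleGraph V) (S : Set V) : Prop :=
  Indep G S ∧ DisconnOrK1 G Sᶜ

/-- `S` is a maximal split independent set. -/
def MaximalSplitIndep (G : SimpleGraph V) (S : Set V) : Prop :=
  SplitIndep G S ∧
    ∀ v ∉ S, ¬ Indep G (S ∪ {v}) ∨ (G.induce (S ∪ {v})ᶜ).Connected

/-- `S` is a split irredundant set: every vertex of `S` has a private neighbor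
with respect to `S`, and `⟨V ∖ S⟩` is disconnected or a `K₁`. -/
def SplitIrred (G : SimpleGraph V) (S : Set V) : Prop :=
  (∀ u ∈ S, HasPrivateNbr G S u) ∧ DisconnOrK1 G Sᶜ

/-- `S` is a maximal split irredundant set. -/
def MaximalSplitIrred (G : SimpleGraph V) (S : Set V) : Prop :=
  SplitIrred G S ∧
    ∀ v ∉ S, ¬ HasPrivateNbr G (S ∪ {v}) v ∨ (G.induce (S ∪ {v})ᶜ).Connected

/-- Split domination number `γₛ(G)`. -/
noncomputable def gammaS (G : SimpleGraph V) : ℕ :=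
  sInf {n | ∃ S : Set V, SplitDominating G S ∧ S.ncard = n}

/-- Upper split domination number `Γₛ(G)`. -/
noncomputable def GammaS (G : SimpleGraph V) : ℕ :=
  sSup {n | ∃ S : Set V, MinimalSplitDominating G S ∧ S.ncard = n}

/-- Lower split independence number `iₛ(G)`. -/
noncomputable def iS (G : SimpleGraph V) : ℕ :=
  sInf {n | ∃ S : Set V, MaximalSplitIndep G S ∧ S.ncard = n}

/-- Split independence number `βₛ(G)`. -/
noncomputable def betaS (G : SimpleGraph V) : ℕ :=
  sSup {n | ∃ S : Set V, MaximalSplitIndep G S ∧ S.ncard = n}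

/-- Lower split irredundance number `irₛ(G)`. -/
noncomputable def irS (G : SimpleGraph V) : ℕ :=
  sInf {n | ∃ S : Set V, MaximalSplitIrred G S ∧ S.ncard = n}

/-- Upper split irredundance number `IRₛ(G)`. -/
noncomputable def IRS (G : SimpleGraph V) : ℕ :=
  sSup {n | ∃ S : Set V, MaximalSplitIrred G S ∧ S.ncard = n}

/-- The vertex connectivity `k(G)`: the minimum size of a set `S`
such that `⟨V ∖ S⟩` is disconnected or a single vertex. -/
noncomputable def connK (G : SimpleGraph V) : ℕ :=
  sInf {n | ∃ S : Set V, DisconnOrK1 G Sᶜ ∧ S.ncard = n}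

/-- `S` is a nonsplit dominating set: dominating and `⟨V ∖ S⟩` is connected. -/
def NonsplitDominating (G : SimpleGraph V) (S : Set V) : Prop :=
  Dominating G S ∧ (G.induce Sᶜ).Connected

/-- `S` is a minimal nonsplit dominating set. -/
def MinimalNonsplitDominating (G : SimpleGraph V) (S : Set V) : Prop :=
  NonsplitDominating G S ∧
    ∀ u ∈ S, HasPrivateNbr G S u ∨ DisconnOrK1 G (Sᶜ ∪ {u})

/-- `S` is a nonsplit independent set: independent and `⟨V ∖ S⟩` is connected. -/
def NonsplitIndep (G : SimpleGraph V) (S : Set V) : Prop :=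
  Indep G S ∧ (G.induce Sᶜ).Connected

/-- `S` is a maximal nonsplit independent set. -/
def MaximalNonsplitIndep (G : SimpleGraph V) (S : Set V) : Prop :=
  NonsplitIndep G S ∧
    ∀ v ∉ S, ¬ Indep G (S ∪ {v}) ∨ DisconnOrK1 G (S ∪ {v})ᶜ

/-- `S` is a nonsplit irredundant set. -/
def NonsplitIrred (G : SimpleGraph V) (S : Set V) : Prop :=
  (∀ u ∈ S, HasPrivateNbr G S u) ∧ (G.induce Sᶜ).Connected

/-- `S` is a maximal nonsplit irredundant set. -/
def MaximalNonsplitIrred (G : SimpleGraph V) (S : Set V) : Prop :=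
  NonsplitIrred G S ∧
    ∀ v ∉ S, ¬ HasPrivateNbr G (S ∪ {v}) v ∨ DisconnOrK1 G (S ∪ {v})ᶜ

/-- Nonsplit domination number `γₙₛ(G)`. -/
noncomputable def gammaNS (G : SimpleGraph V) : ℕ :=
  sInf {n | ∃ S : Set V, NonsplitDominating G S ∧ S.ncard = n}

/-- Upper nonsplit domination number `Γₙₛ(G)`. -/
noncomputable def GammaNS (G : SimpleGraph V) : ℕ :=
  sSup {n | ∃ S : Set V, MinimalNonsplitDominating G S ∧ S.ncard = n}

/-- Lower nonsplit independence number `iₙₛ(G)`. -/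
noncomputable def iNS (G : SimpleGraph V) : ℕ :=
  sInf {n | ∃ S : Set V, MaximalNonsplitIndep G S ∧ S.ncard = n}

/-- Nonsplit independence number `βₙₛ(G)`. -/
noncomputable def betaNS (G : SimpleGraph V) : ℕ :=
  sSup {n | ∃ S : Set V, MaximalNonsplitIndep G S ∧ S.ncard = n}

/-- Lower nonsplit irredundance number `irₙₛ(G)`. -/
noncomputable def irNS (G : SimpleGraph V) : ℕ :=
  sInf {n | ∃ S : Set V, MaximalNonsplitIrred G S ∧ S.ncard = n}

/-- `G` is a 2-tree: it can be built from `K₃` by repeatedly adding a new vertex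
adjacent to exactly the two endpoints of an existing edge.  This is expressed via a
construction ordering of the vertices. -/
def IsTwoTree [Fintype V] (G : SimpleGraph V) : Prop :=
  ∃ (n : ℕ) (_ : 3 ≤ n) (e : V ≃ Fin n),
    (∀ i j : Fin n, i ≠ j → i.val < 3 → j.val < 3 → G.Adj (e.symm i) (e.symm j)) ∧
    (∀ i : Fin n, 3 ≤ i.val → ∃ j k : Fin n, j < i ∧ k < i ∧ j ≠ k ∧
      G.Adj (e.symm j) (e.symm k) ∧
      (∀ l : Fin n, l < i → (G.Adj (e.symm l) (e.symm i) ↔ l = j ∨ l = k)))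

/-- Two adjacent vertices are not both in an independent set. -/
theorem Indep.notMem_or_notMem {G : SimpleGraph V} {S : Set V} (hS : Indep G S) {u v : V}
    (h : G.Adj u v) : u ∉ S ∨ v ∉ S := by
  by_contra! hmem
  exact hS hmem.1 hmem.2 h

/-- In a graph with a triangle, some edge avoids a given independent set. -/
theorem Indep.exists_adj_notMem_of_triangle {G : SimpleGraph V} {S : Set V} (hS : Indep G S)
    {a b c : V} (hab : G.Adj a b) (hac : G.Adj a c) (hbc : G.Adj b c) :
    ∃ u ∈ ({a, b, c} : Set V), ∃ v, G.Adj u v ∧ u ∉ S ∧ v ∉ S := by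
  by_cases ha : a ∈ S
  · exact ⟨b, by simp, c, hbc, fun hb => hS ha hb hab, fun hc => hS ha hc hac⟩
  · rcases hS.notMem_or_notMem hbc with hb | hc
    · exact ⟨a, by simp, b, hab, ha, hb⟩
    · exact ⟨a, by simp, c, hac, ha, hc⟩

/-- In a 2-tree, the complement of an independent set contains an edge, and it induces a
connected subgraph. -/
theorem IsTwoTree.exists_adj_and_connected_induce_compl [Fintype V] {G : SimpleGraph V}
    (hG : IsTwoTree G) {S : Set V} (hS : Indep G S) :
    (∃ u v, G.Adj u v ∧ u ∉ S ∧ v ∉ S) ∧ (G.induce Sᶜ).Connected := by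
  obtain ⟨n, hn, e, hbase, hstep⟩ := hG
  have hadj (i j : ℕ) (hi : i < 3) (hj : j < 3) (hij : i ≠ j) :
      G.Adj (e.symm ⟨i, by omega⟩) (e.symm ⟨j, by omega⟩) :=
    hbase _ _ (by simpa using hij) hi hj
  obtain ⟨r, hr, v, hrv, hrS, hvS⟩ := hS.exists_adj_notMem_of_triangle
    (hadj 0 1 (by omega) (by omega) (by omega)) (hadj 0 2 (by omega) (by omega) (by omega))
    (hadj 1 2 (by omega) (by omega) (by omega))
  have hr3 : (e r).val < 3 := by
    rcases hr with rfl | rfl | rfl <;> simp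
  refine ⟨⟨r, v, hrv, hrS, hvS⟩, ?_⟩
  have hreach (i : Fin n) (hi : e.symm i ∈ Sᶜ) :
      (G.induce Sᶜ).Reachable ⟨e.symm i, hi⟩ ⟨r, hrS⟩ := by
    induction i using WellFoundedLT.induction with
    | ind i ih =>
      have of_adj (l : Fin n) (hli : l < i) (hl : e.symm l ∉ S)
          (h : G.Adj (e.symm l) (e.symm i)) :
          (G.induce Sᶜ).Reachable ⟨e.symm i, hi⟩ ⟨r, hrS⟩ :=
        have h' : (G.induce Sᶜ).Adj ⟨e.symm i, hi⟩ ⟨e.symm l, hl⟩ := h.symm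
        h'.reachable.trans (ih l hli hl)
      by_cases hi3 : i.val < 3
      · by_cases hir : i = e r
        · subst hir
          simp
        · have h := hbase i (e r) hir hi3 hr3
          rw [e.symm_apply_apply] at h
          exact Adj.reachable h
      · obtain ⟨j, k, hji, hki, -, hjk, hnbr⟩ := hstep i (by omega)
        rcases hS.notMem_or_notMem hjk with hj | hk
        · exact of_adj j hji hj ((hnbr j hji).2 (.inl rfl))
        · exact of_adj k hki hk ((hnbr k hki).2 (.inr rfl))
  rw [connected_iff_exists_forall_reachable]
  refine ⟨⟨r, hrS⟩, fun ⟨w, hw⟩ => ?_⟩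
  simpa using (hreach (e w) (by simpa using hw)).symm

/-- A 2-tree contains no split independent set. -/
theorem twoTree_no_splitIndep {V : Type*} [Fintype V] (G : SimpleGraph V)
    (hG : IsTwoTree G) :
    ¬ ∃ S : Set V, SplitIndep G S := by
  rintro ⟨S, hS, hsplit⟩
  obtain ⟨⟨u, v, huv, hu, hv⟩, hconn⟩ := hG.exists_adj_and_connected_induce_compl hS
  rcases hsplit with hdis | hone
  · exact hdis hconn
  · obtain ⟨w, hw⟩ := Set.ncard_eq_one.1 hone
    have huw : u = w := by simpa [hw] using (show u ∈ Sᶜ from hu)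
    have hvw : v = w := by simpa [hw] using (show v ∈ Sᶜ from hv)
    exact huv.ne (huw.trans hvw.symm)

end SplitDomination
end

section
/- Let G be a finite simple connected graph with no isolated vertices. If S is a maximal split independent set of G, then S is a minimal split dominating set of G. -/
open SimpleGraph

namespace SplitDomination

variable {V : Type*}

theorem Indep.hasPrivateNbr {G : SimpleGraph V} {S : Set V} (hS : Indep G S) {u : V}
    (hu : u ∈ S) : HasPrivateNbr G S u := by
  refine ⟨u, Or.inl rfl, ?_⟩
  rintro (h | ⟨x, hx, hxu⟩)
  · exact h.2 rfl
  · exact hS hx.1 hu hxu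

theorem Indep.union_singleton {G : SimpleGraph V} {S : Set V} (hS : Indep G S) {v : V}
    (hv : ∀ u ∈ S, ¬ G.Adj u v) : Indep G (S ∪ {v}) := by
  rintro a (ha | rfl) b (hb | rfl)
  · exact hS ha hb
  · exact hv a ha
  · exact fun h => hv b hb h.symm
  · exact G.irrefl

theorem MaximalSplitIndep.dominating {G : SimpleGraph V} (hiso : NoIsolated G)
    {S : Set V} (hS : MaximalSplitIndep G S) : Dominating G S := by
  intro v hv
  by_contra! hnbr
  have hconn : (G.induce (S ∪ {v})ᶜ).Connected :=
    (hS.2 v hv).resolve_left fun h => h (hS.1.1.union_singleton hnbr)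
  obtain ⟨w, hwv⟩ := hiso v
  have hwS : w ∉ S := fun h => hnbr w h hwv
  have hcompl : Sᶜ = (S ∪ {v})ᶜ ∪ {w, v} := by
    ext x
    by_cases hxv : x = v
    · simp [hxv, hv]
    · by_cases hxw : x = w <;> simp [hxv, hxw, hwS, hwv.ne]
  rcases hS.1.2 with h | h
  · apply h
    rw [hcompl]
    exact induce_union_connected hconn.preconnected
      (induce_pair_connected_of_adj hwv).preconnected ⟨w, by simp [hwS, hwv.ne], by simp⟩
  · obtain ⟨x, hx⟩ := Set.ncard_eq_one.mp h
    have hvx : v ∈ ({x} : Set V) := hx ▸ hv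
    have hwx : w ∈ ({x} : Set V) := hx ▸ hwS
    exact hwv.ne (hwx.trans hvx.symm)

/-- In a finite connected graph with no isolated vertices,
every maximal split independent set is a minimal split dominating set. -/
theorem maximalSplitIndep_minimalSplitDominating {V : Type*} [Fintype V]
    (G : SimpleGraph V) (hconn : G.Connected) (hiso : NoIsolated G)
    (S : Set V) (hS : MaximalSplitIndep G S) :
    MinimalSplitDominating G S := by
  exact ⟨⟨hS.dominating hiso, hS.1.2⟩, fun u hu => Or.inl (hS.1.1.hasPrivateNbr hu)⟩

end SplitDomination
end

section
/- Let G be a finite simple connected graph with no isolated vertices that possesses a maximal split independent set. Then γ_s(G) ≤ i_s(G). -/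
open SimpleGraph

namespace SplitDomination

variable {V : Type*}

/-- If `G` possesses a maximal split independent set,
then `γₛ(G) ≤ iₛ(G)`. -/
theorem gammaS_le_iS {V : Type*} [Fintype V]
    (G : SimpleGraph V) (hconn : G.Connected) (hiso : NoIsolated G)
    (hex : ∃ S : Set V, MaximalSplitIndep G S) :
    gammaS G ≤ iS G := by
  obtain ⟨S, hS, hcard⟩ : iS G ∈ {n | ∃ S : Set V, MaximalSplitIndep G S ∧ S.ncard = n} :=
    Nat.sInf_mem (hex.imp' _ fun S hS => ⟨S, hS, rfl⟩)
  exact Nat.sInf_le ⟨S, ⟨hS.dominating hiso, hS.1.2⟩, hcard⟩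

end SplitDomination
end

section
/- For the complete bipartite graph K_{m,n} with 1 ≤ m ≤ n and n ≥ 2, the lower split parameters satisfy ir_s(K_{m,n}) = γ_s(K_{m,n}) = i_s(K_{m,n}) = m = min{m,n}. -/
open SimpleGraph

namespace SplitDomination

variable {V : Type*}

section CompleteBipartite

variable {α β : Type*}

lemma induce_completeBipartiteGraph_connected {T : Set (α ⊕ β)} {a : α} {b : β}
    (ha : Sum.inl a ∈ T) (hb : Sum.inr b ∈ T) :
    ((completeBipartiteGraph α β).induce T).Connected := by
  have key : ∀ x : T, ((completeBipartiteGraph α β).induce T).Reachable x ⟨_, ha⟩ := by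
    have hba : ((completeBipartiteGraph α β).induce T).Adj ⟨_, hb⟩ ⟨_, ha⟩ := by simp
    rintro ⟨x | y, hx⟩
    · have hxb : ((completeBipartiteGraph α β).induce T).Adj ⟨_, hx⟩ ⟨_, hb⟩ := by simp
      exact hxb.reachable.trans hba.reachable
    · have hya : ((completeBipartiteGraph α β).induce T).Adj ⟨_, hx⟩ ⟨_, ha⟩ := by simp
      exact hya.reachable
  exact (connected_iff _).2 ⟨fun x y => (key x).trans (key y).symm, ⟨⟨_, ha⟩⟩⟩

lemma DisconnOrK1.range_inl_subset_or_range_inr_subset {S : Set (α ⊕ β)}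
    (h : DisconnOrK1 (completeBipartiteGraph α β) Sᶜ) :
    Set.range Sum.inl ⊆ S ∨ Set.range Sum.inr ⊆ S := by
  by_contra! hc
  obtain ⟨_, ⟨a, rfl⟩, ha⟩ := Set.not_subset.1 hc.1
  obtain ⟨_, ⟨b, rfl⟩, hb⟩ := Set.not_subset.1 hc.2
  rcases h with h | h
  · exact h (induce_completeBipartiteGraph_connected ha hb)
  · obtain ⟨x, hx⟩ := Set.ncard_eq_one.1 h
    have h₁ : Sum.inl a = x := by simpa [hx] using (show Sum.inl a ∈ Sᶜ from ha)
    have h₂ : Sum.inr b = x := by simpa [hx] using (show Sum.inr b ∈ Sᶜ from hb)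
    simp [← h₂] at h₁

lemma DisconnOrK1.min_card_le_ncard [Finite α] [Finite β] {S : Set (α ⊕ β)}
    (h : DisconnOrK1 (completeBipartiteGraph α β) Sᶜ) :
    min (Nat.card α) (Nat.card β) ≤ S.ncard := by
  rcases h.range_inl_subset_or_range_inr_subset with h | h
  · refine (min_le_left _ _).trans ?_
    rw [← Set.ncard_range_of_injective (Sum.inl_injective (α := α) (β := β))]
    exact Set.ncard_le_ncard h
  · refine (min_le_right _ _).trans ?_
    rw [← Set.ncard_range_of_injective (Sum.inr_injective (α := α) (β := β))]
    exact Set.ncard_le_ncard h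

lemma disconnOrK1_compl_range_inl [Nontrivial β] :
    DisconnOrK1 (completeBipartiteGraph α β) (Set.range Sum.inl)ᶜ := by
  left
  intro h
  obtain ⟨b, c, hbc⟩ := exists_pair_ne β
  have hb : (Sum.inr b : α ⊕ β) ∈ (Set.range Sum.inl)ᶜ := by simp
  have hc : (Sum.inr c : α ⊕ β) ∈ (Set.range Sum.inl)ᶜ := by simp
  have : Nontrivial ((Set.range (Sum.inl : α → α ⊕ β))ᶜ : Set (α ⊕ β)) :=
    ⟨⟨_, hb⟩, ⟨_, hc⟩, by simpa using hbc⟩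
  obtain ⟨⟨x | y, hx⟩, hadj⟩ := h.preconnected.exists_adj_of_nontrivial ⟨_, hb⟩
  · simp at hx
  · simp at hadj

lemma splitDominating_range_inl [Nonempty α] [Nontrivial β] :
    SplitDominating (completeBipartiteGraph α β) (Set.range Sum.inl) := by
  refine ⟨?_, disconnOrK1_compl_range_inl⟩
  rintro (x | y) hv
  · simp at hv
  · exact ⟨_, ⟨Classical.arbitrary α, rfl⟩, by simp⟩

lemma maximalSplitIndep_range_inl [Nonempty α] [Nontrivial β] :
    MaximalSplitIndep (completeBipartiteGraph α β) (Set.range Sum.inl) := by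
  refine ⟨⟨?_, disconnOrK1_compl_range_inl⟩, ?_⟩
  · rintro _ ⟨a, rfl⟩ _ ⟨b, rfl⟩
    simp
  · rintro (x | y) hv
    · simp at hv
    · exact Or.inl fun h => h (Or.inl ⟨Classical.arbitrary α, rfl⟩) (Or.inr rfl) (by simp)

lemma maximalSplitIrred_range_inl [Nonempty α] [Nontrivial β] :
    MaximalSplitIrred (completeBipartiteGraph α β) (Set.range Sum.inl) := by
  refine ⟨⟨?_, disconnOrK1_compl_range_inl⟩, ?_⟩
  · rintro _ ⟨a, rfl⟩
    refine ⟨Sum.inl a, Or.inl rfl, ?_⟩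
    rintro (h | ⟨_, ⟨⟨b, rfl⟩, -⟩, h⟩)
    · exact h.2 rfl
    · simp at h
  · rintro (x | y) hv
    · simp at hv
    · left
      rintro ⟨x | z, hw, hn⟩
      · exact hn (Or.inl (by simp))
      · exact hn (Or.inr ⟨Sum.inl (Classical.arbitrary α), by simp, by simp⟩)

end CompleteBipartite

/-- For `K_{m,n}` with `1 ≤ m ≤ n`, `n ≥ 2`:
`irₛ = γₛ = iₛ = m = min{m,n}`. -/
theorem completeBipartite_lower_split_params (m n : ℕ)
    (hm : 1 ≤ m) (hmn : m ≤ n) (hn : 2 ≤ n) :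
    irS (completeBipartiteGraph (Fin m) (Fin n)) = m ∧
    gammaS (completeBipartiteGraph (Fin m) (Fin n)) = m ∧
    iS (completeBipartiteGraph (Fin m) (Fin n)) = m ∧
    m = min m n := by
  have : Nonempty (Fin m) := ⟨⟨0, hm⟩⟩
  have : Nontrivial (Fin n) := Fin.nontrivial_iff_two_le.2 hn
  have hcard : (Set.range (Sum.inl : Fin m → Fin m ⊕ Fin n)).ncard = m := by
    rw [Set.ncard_range_of_injective Sum.inl_injective, Nat.card_fin]
  have hle : ∀ {S : Set (Fin m ⊕ Fin n)},
      DisconnOrK1 (completeBipartiteGraph (Fin m) (Fin n)) Sᶜ → m ≤ S.ncard := fun h => by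
    simpa [hmn] using h.min_card_le_ncard
  have hinf : ∀ {P : Set (Fin m ⊕ Fin n) → Prop}, P (Set.range Sum.inl) →
      (∀ S, P S → DisconnOrK1 (completeBipartiteGraph (Fin m) (Fin n)) Sᶜ) →
      sInf {k | ∃ S, P S ∧ S.ncard = k} = m := fun hP hS =>
    IsLeast.csInf_eq ⟨⟨_, hP, hcard⟩, by rintro _ ⟨S, hPS, rfl⟩; exact hle (hS S hPS)⟩
  exact ⟨hinf maximalSplitIrred_range_inl fun _ h => h.1.2,
    hinf splitDominating_range_inl fun _ h => h.2,
    hinf maximalSplitIndep_range_inl fun _ h => h.1.2, (min_eq_left hmn).symm⟩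

end SplitDomination
end

section
/- For the path P_n on n ≥ 4 vertices, the nonsplit domination number satisfies γ_ns(P_n) = n − 2. -/
open SimpleGraph

namespace SplitDomination

variable {V : Type*}

/-- A set of vertices inducing a preconnected subgraph of a path is an interval. -/
theorem mem_of_preconnected_induce_pathGraph {n : ℕ} {T : Set (Fin n)}
    (hT : ((SimpleGraph.pathGraph n).induce T).Preconnected) {a b c : Fin n}
    (ha : a ∈ T) (hc : c ∈ T) (hab : a < b) (hbc : b < c) : b ∈ T := by
  by_contra hb
  have side : ∀ x y : T, ((SimpleGraph.pathGraph n).induce T).Reachable x y →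
      x.1 < b → y.1 < b := by
    rintro x y ⟨p⟩
    induction p with
    | nil => exact id
    | @cons u v w huv _ ih =>
      intro hu
      refine ih ?_
      have hne : v.1 ≠ b := fun h => hb (h ▸ v.2)
      have hadj := SimpleGraph.pathGraph_adj.mp (SimpleGraph.induce_adj.mp huv)
      rw [ne_eq, Fin.ext_iff] at hne
      rw [Fin.lt_def] at hu ⊢
      omega
  exact (side ⟨a, ha⟩ ⟨c, hc⟩ (hT _ _) hab).asymm hbc

/-- Two vertices outside a nonsplit dominating set of a path are consecutive. -/
theorem NonsplitDominating.succ_eq_of_lt {n : ℕ} {S : Set (Fin n)}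
    (hS : NonsplitDominating (SimpleGraph.pathGraph n) S) {u w : Fin n}
    (hu : u ∉ S) (hw : w ∉ S) (huw : u < w) : u.val + 1 = w.val := by
  by_contra hne
  rw [Fin.lt_def] at huw
  have hwn := w.isLt
  have interval : ∀ x : Fin n, u.val < x.val → x.val ≤ w.val → x ∉ S := by
    intro x hux hxw
    rcases hxw.eq_or_lt with h | h
    · rwa [Fin.ext h]
    · exact mem_of_preconnected_induce_pathGraph hS.2.preconnected
        (Set.mem_compl hu) (Set.mem_compl hw) (Fin.lt_def.mpr hux) (Fin.lt_def.mpr h)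
  obtain ⟨x, hxS, hx⟩ := hS.1 ⟨u.val + 1, by omega⟩ (interval _ (by simp) (by simp; omega))
  rw [SimpleGraph.pathGraph_adj] at hx
  simp only at hx
  by_cases hxu : x = u
  · exact hu (hxu ▸ hxS)
  · rw [Fin.ext_iff] at hxu
    exact interval x (by omega) (by omega) hxS

theorem NonsplitDominating.sub_two_le_ncard {n : ℕ} {S : Set (Fin n)}
    (hS : NonsplitDominating (SimpleGraph.pathGraph n) S) : n - 2 ≤ S.ncard := by
  have hle : Sᶜ.ncard ≤ 2 := by
    by_contra! h
    obtain ⟨a, ha, b, hb, c, hc, hab, hac, hbc⟩ := (Set.two_lt_ncard (Set.toFinite _)).mp h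
    have consecutive : ∀ x ∈ Sᶜ, ∀ y ∈ Sᶜ, x ≠ y → x.val + 1 = y.val ∨ y.val + 1 = x.val := by
      intro x hx y hy hxy
      rcases lt_or_gt_of_ne hxy with h | h
      · exact Or.inl (hS.succ_eq_of_lt hx hy h)
      · exact Or.inr (hS.succ_eq_of_lt hy hx h)
    have h₁ := consecutive a ha b hb hab
    have h₂ := consecutive a ha c hc hac
    have h₃ := consecutive b hb c hc hbc
    omega
  have hadd := Set.ncard_add_ncard_compl S
  rw [Nat.card_fin] at hadd
  omega

theorem exists_nonsplitDominating_pathGraph {n : ℕ} (hn : 4 ≤ n) :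
    ∃ S : Set (Fin n), NonsplitDominating (SimpleGraph.pathGraph n) S ∧ S.ncard = n - 2 := by
  let v : ∀ i < 4, Fin n := fun i hi => ⟨i, by omega⟩
  have hne : v 1 (by omega) ≠ v 2 (by omega) := by simp [v]
  refine ⟨{v 1 (by omega), v 2 (by omega)}ᶜ, ⟨?_, ?_⟩, ?_⟩
  · intro w hw
    rcases Set.notMem_compl_iff.mp hw with rfl | rfl
    · exact ⟨v 0 (by omega), by simp [v], by simp [v, SimpleGraph.pathGraph_adj]⟩
    · exact ⟨v 3 (by omega), by simp [v], by simp [v, SimpleGraph.pathGraph_adj]⟩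
  · rw [compl_compl]
    exact SimpleGraph.induce_pair_connected_of_adj (by simp [v, SimpleGraph.pathGraph_adj])
  · rw [Set.ncard_compl, Set.ncard_pair hne, Nat.card_fin]

/-- For the path `Pₙ`, `n ≥ 4`: `γₙₛ(Pₙ) = n - 2`. -/
theorem path_gammaNS (n : ℕ) (hn : 4 ≤ n) :
    gammaNS (SimpleGraph.pathGraph n) = n - 2 := by
  obtain ⟨S, hS, hcard⟩ := exists_nonsplitDominating_pathGraph hn
  refine le_antisymm (Nat.sInf_le ⟨S, hS, hcard⟩) (le_csInf ⟨_, S, hS, hcard⟩ ?_)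
  rintro _ ⟨T, hT, rfl⟩
  exact hT.sub_two_le_ncard

end SplitDomination
end

section
/- For the path P_n on n ≥ 4 vertices, the nonsplit independence parameters satisfy i_ns(P_n) = β_ns(P_n) = 2. -/
open SimpleGraph

namespace SplitDomination

variable {V : Type*}

theorem pathGraph_induce_connected_iff {n : ℕ} {T : Set (Fin n)} :
    ((pathGraph n).induce T).Connected ↔ T.Nonempty ∧ T.OrdConnected := by
  constructor
  · intro h
    refine ⟨Set.nonempty_coe_sort.mp h.nonempty, ⟨fun a ha b hb v hv => ?_⟩⟩
    by_contra hvT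
    have key : ∀ x y : T, ((pathGraph n).induce T).Walk x y → (x : Fin n) < v → (y : Fin n) < v := by
      intro x y w
      induction w with
      | nil => exact id
      | @cons x z y hxz _ ih =>
        intro hx
        refine ih ?_
        have hz : (z : Fin n) ≠ v := fun e => hvT (e ▸ z.2)
        rw [comap_adj, pathGraph_adj] at hxz
        simp only [Function.Embedding.subtype_apply] at hxz
        omega
    have hav : a < v := lt_of_le_of_ne hv.1 fun e => hvT (e ▸ ha)
    obtain ⟨w⟩ := h.preconnected ⟨a, ha⟩ ⟨b, hb⟩
    exact (key _ _ w hav).not_ge hv.2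
  · rintro ⟨hne, hT⟩
    have key : ∀ (k : ℕ) (a b : T), (a : Fin n).val + k = (b : Fin n).val →
        ((pathGraph n).induce T).Reachable a b := by
      intro k
      induction k with
      | zero =>
        intro a b hab
        rw [Subtype.ext (Fin.ext hab : (a : Fin n) = b)]
      | succ k ih =>
        intro a b hab
        let c : Fin n := ⟨(a : Fin n).val + 1, by omega⟩
        have hc : c ∈ T := hT.out a.2 b.2
          ⟨Fin.le_def.mpr (by simp [c]), Fin.le_def.mpr (by simp only [c]; omega)⟩
        have hadj : ((pathGraph n).induce T).Adj a ⟨c, hc⟩ := by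
          rw [comap_adj, pathGraph_adj]
          exact Or.inl rfl
        exact hadj.reachable.trans (ih ⟨c, hc⟩ b (by simp only [c]; omega))
    have : Nonempty T := hne.to_subtype
    refine ⟨fun a b => ?_⟩
    rcases le_total (a : Fin n).val (b : Fin n).val with h | h
    · exact key _ a b (Nat.add_sub_cancel' h)
    · exact (key _ b a (Nat.add_sub_cancel' h)).symm

theorem nonsplitIndep_pathGraph_iff {m : ℕ} {S : Set (Fin (m + 3))} :
    NonsplitIndep (pathGraph (m + 3)) S ↔ S ⊆ {0, Fin.last (m + 2)} := by
  rw [NonsplitIndep, pathGraph_induce_connected_iff]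
  constructor
  · rintro ⟨hI, -, hT⟩ v hv
    by_contra hne
    simp only [Set.mem_insert_iff, Set.mem_singleton_iff, not_or, Fin.ext_iff, Fin.val_zero,
      Fin.val_last] at hne
    let a : Fin (m + 3) := ⟨v.val - 1, by omega⟩
    let b : Fin (m + 3) := ⟨v.val + 1, by omega⟩
    have ha : a ∈ Sᶜ := fun h => hI h hv (pathGraph_adj.mpr (Or.inl (by simp only [a]; omega)))
    have hb : b ∈ Sᶜ := fun h => hI hv h (pathGraph_adj.mpr (Or.inl rfl))
    exact hT.out ha hb
      ⟨Fin.le_def.mpr (by simp [a]), Fin.le_def.mpr (by simp [b])⟩ hv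
  · intro hS
    have ends : ∀ v ∈ S, v.val = 0 ∨ v.val = m + 2 := fun v hv =>
      (hS hv).imp (congrArg Fin.val) (congrArg Fin.val)
    refine ⟨fun u hu v hv huv => ?_, ⟨⟨1, by omega⟩, fun h => ?_⟩,
      ⟨fun a ha b hb v hv hvS => ?_⟩⟩
    · have := ends u hu
      have := ends v hv
      rw [pathGraph_adj] at huv
      omega
    · have := ends _ h
      simp only at this
      omega
    · have hva : v ≠ a := fun e => ha (e ▸ hvS)
      have hvb : v ≠ b := fun e => hb (e ▸ hvS)
      have := ends v hvS
      have := hv.1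
      have := hv.2
      omega

theorem maximalNonsplitIndep_pathGraph_iff {m : ℕ} {S : Set (Fin (m + 4))} :
    MaximalNonsplitIndep (pathGraph (m + 4)) S ↔ S = {0, Fin.last (m + 3)} := by
  constructor
  · rintro ⟨hS, hmax⟩
    have hsub := nonsplitIndep_pathGraph_iff.mp hS
    refine hsub.antisymm fun v hv => ?_
    by_contra hvS
    have hsub' : S ∪ {v} ⊆ {0, Fin.last (m + 3)} :=
      Set.union_subset hsub (Set.singleton_subset_iff.mpr hv)
    have hSv := nonsplitIndep_pathGraph_iff.mpr hsub'
    rcases hmax v hvS with h | h | h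
    · exact h hSv.1
    · exact h hSv.2
    · obtain ⟨x, hx⟩ := Set.ncard_eq_one.mp h
      have interior : ∀ k : Fin (m + 4), 0 < k.val → k.val < m + 3 → k = x := by
        intro k h0 h1
        have hk : k ∈ (S ∪ {v})ᶜ := fun hk => by
          have := hsub' hk
          simp only [Set.mem_insert_iff, Set.mem_singleton_iff, Fin.ext_iff, Fin.val_zero,
            Fin.val_last] at this
          omega
        rwa [hx] at hk
      have h12 := (interior ⟨1, by omega⟩ (by simp) (by simp)).trans
        (interior ⟨2, by omega⟩ (by simp) (by simp)).symm
      exact absurd (Fin.mk.inj h12) (by decide)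
  · rintro rfl
    refine ⟨nonsplitIndep_pathGraph_iff.mpr subset_rfl, fun v hv => ?_⟩
    by_contra! h
    obtain ⟨hI, hD⟩ := h
    rw [DisconnOrK1, not_or, not_not] at hD
    exact hv (nonsplitIndep_pathGraph_iff.mp ⟨hI, hD.1⟩ (Or.inr rfl))

/-- For the path `Pₙ`, `n ≥ 4`: `iₙₛ(Pₙ) = βₙₛ(Pₙ) = 2`. -/
theorem path_nonsplit_indep_params (n : ℕ) (hn : 4 ≤ n) :
    iNS (SimpleGraph.pathGraph n) = 2 ∧
    betaNS (SimpleGraph.pathGraph n) = 2 := by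
  obtain ⟨m, rfl⟩ := Nat.exists_eq_add_of_le' hn
  have hcard : ({0, Fin.last (m + 3)} : Set (Fin (m + 4))).ncard = 2 :=
    Set.ncard_pair (by simp [Fin.ext_iff])
  have hset : {k | ∃ S : Set (Fin (m + 4)),
      MaximalNonsplitIndep (pathGraph (m + 4)) S ∧ S.ncard = k} = {2} := by
    ext k
    simp only [maximalNonsplitIndep_pathGraph_iff, exists_eq_left, hcard, Set.mem_ofPred_eq,
      Set.mem_singleton_iff, eq_comm]
  rw [iNS, betaNS, hset]
  exact ⟨csInf_singleton 2, csSup_singleton 2⟩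

end SplitDomination
end

section
/- For the cycle C_n on n ≥ 4 vertices: γ_ns(C_n) = Γ_ns(C_n) = n − 2, and i_ns(C_n) = β_ns(C_n) = 1. -/
open SimpleGraph

namespace SplitDomination

variable {V : Type*}

/-- A set containing a vertex of a connected `⟨T⟩` and closed under adjacency in `T` covers `T`. -/
theorem subset_of_induce_connected {G : SimpleGraph V} {T A : Set V}
    (hT : (G.induce T).Connected) {t : V} (ht : t ∈ T) (htA : t ∈ A)
    (hA : ∀ x ∈ A, x ∈ T → ∀ y ∈ T, G.Adj x y → y ∈ A) : T ⊆ A := by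
  intro y hy
  obtain ⟨p⟩ := hT.preconnected ⟨t, ht⟩ ⟨y, hy⟩
  have key : ∀ (a b : T), (G.induce T).Walk a b → a.1 ∈ A → b.1 ∈ A := by
    intro a b p
    induction p with
    | nil => exact id
    | cons h _ ih => exact fun ha => ih (hA _ ha (Subtype.property _) _ (Subtype.property _) h)
  exact key _ _ p htA

/-- In a nonsplit dominating set, the complement has at most two vertices as soon as
every vertex has at most two neighbors. -/
theorem NonsplitDominating.ncard_compl_le_two {G : SimpleGraph V} {S : Set V}
    (hG : ∀ v a b c, G.Adj v a → G.Adj v b → G.Adj v c → a = b ∨ a = c ∨ b = c)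
    (hS : NonsplitDominating G S) : Sᶜ.ncard ≤ 2 := by
  obtain ⟨hdom, hconn⟩ := hS
  have hdeg : ∀ v ∈ Sᶜ, ∀ a ∈ Sᶜ, ∀ b ∈ Sᶜ, G.Adj v a → G.Adj v b → a = b := by
    intro v hv a ha b hb hva hvb
    obtain ⟨c, hc, hcv⟩ := hdom v hv
    rcases hG v a b c hva hvb hcv.symm with h | rfl | rfl
    · exact h
    · exact absurd hc ha
    · exact absurd hc hb
  obtain ⟨⟨t, ht⟩⟩ := hconn.nonempty
  by_cases h : ∃ s ∈ Sᶜ, G.Adj t s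
  · obtain ⟨s, hs, hts⟩ := h
    have hsub : Sᶜ ⊆ {t, s} := by
      refine subset_of_induce_connected hconn ht (by simp) ?_
      rintro x (rfl | rfl) hx y hy hxy
      · exact Or.inr (hdeg _ hx _ hy _ hs hxy hts)
      · exact Or.inl (hdeg _ hx _ hy _ ht hxy hts.symm)
    refine (Set.ncard_le_ncard hsub (Set.toFinite _)).trans ?_
    simpa using Set.ncard_insert_le t {s}
  · have hsub : Sᶜ ⊆ {t} := by
      refine subset_of_induce_connected hconn ht rfl ?_
      rintro x rfl hx y hy hxy
      exact absurd ⟨y, hy, hxy⟩ h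
    have := Set.ncard_le_ncard hsub (Set.toFinite _)
    rw [Set.ncard_singleton] at this
    omega

section Cycle

variable {n : ℕ}

theorem cycleGraph_adj_iff_val (hn : 4 ≤ n) (u v : Fin n) :
    (cycleGraph n).Adj u v ↔ u.val + 1 = v.val ∨ v.val + 1 = u.val ∨
      (u.val = 0 ∧ v.val + 1 = n) ∨ (v.val = 0 ∧ u.val + 1 = n) := by
  rw [cycleGraph_adj']
  have hu := u.isLt
  have hv := v.isLt
  simp only [Fin.val_sub]
  have key : ∀ a b : ℕ, a < n → b < n →
      ((n - b + a) % n = 1 ↔ b + 1 = a ∨ (a = 0 ∧ b + 1 = n)) := by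
    intro a b ha hb
    rcases lt_or_ge a b with h | h
    · rw [Nat.mod_eq_of_lt (by omega)]; omega
    · rw [Nat.mod_eq_sub_mod (by omega), Nat.mod_eq_of_lt (by omega)]; omega
  rw [key _ _ hu hv, key _ _ hv hu]
  omega

theorem cycleGraph_eq_of_adj_three (hn : 4 ≤ n) (v a b c : Fin n)
    (ha : (cycleGraph n).Adj v a) (hb : (cycleGraph n).Adj v b) (hc : (cycleGraph n).Adj v c) :
    a = b ∨ a = c ∨ b = c := by
  rw [cycleGraph_adj_iff_val hn] at ha hb hc
  simp only [Fin.ext_iff]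
  omega

theorem cycleGraph_exists_succ (hn : 4 ≤ n) (v : Fin n) :
    ∃ u : Fin n, (cycleGraph n).Adj v u ∧
      (u.val = v.val + 1 ∨ (u.val = 0 ∧ v.val + 1 = n)) := by
  by_cases h : v.val + 1 < n
  · exact ⟨⟨v.val + 1, h⟩, by rw [cycleGraph_adj_iff_val hn]; simp, by simp⟩
  · exact ⟨⟨0, by omega⟩, by rw [cycleGraph_adj_iff_val hn]; simp; omega, by simp; omega⟩

theorem cycleGraph_exists_pred (hn : 4 ≤ n) (v : Fin n) :
    ∃ u : Fin n, (cycleGraph n).Adj v u ∧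
      (v.val = u.val + 1 ∨ (v.val = 0 ∧ u.val + 1 = n)) := by
  by_cases h : v.val = 0
  · exact ⟨⟨n - 1, by omega⟩, by rw [cycleGraph_adj_iff_val hn]; simp; omega, by simp; omega⟩
  · exact ⟨⟨v.val - 1, by omega⟩, by rw [cycleGraph_adj_iff_val hn]; simp; omega, by simp; omega⟩

theorem cycleGraph_exists_adj_ne (hn : 4 ≤ n) (v u : Fin n) :
    ∃ w, (cycleGraph n).Adj v w ∧ w ≠ u := by
  obtain ⟨a, ha, ha'⟩ := cycleGraph_exists_succ hn v
  obtain ⟨b, hb, hb'⟩ := cycleGraph_exists_pred hn v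
  by_cases h : a = u
  · refine ⟨b, hb, ?_⟩
    simp only [ne_eq, Fin.ext_iff] at h ⊢
    omega
  · exact ⟨a, ha, h⟩

/-- Deleting the vertex `0` from a cycle leaves a connected graph. -/
theorem cycleGraph_induce_compl_zero_connected (hn : 4 ≤ n) :
    ((cycleGraph n).induce ({⟨0, by omega⟩} : Set (Fin n))ᶜ).Connected := by
  set T : Set (Fin n) := ({⟨0, by omega⟩} : Set (Fin n))ᶜ with hT
  have mem : ∀ k (hk : k + 1 < n), (⟨k + 1, hk⟩ : Fin n) ∈ T := by
    intro k hk
    simp [hT]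
  rw [connected_iff_exists_forall_reachable]
  refine ⟨⟨⟨1, by omega⟩, mem 0 (by omega)⟩, ?_⟩
  have key : ∀ k (hk : k + 1 < n), ((cycleGraph n).induce T).Reachable
      ⟨⟨1, by omega⟩, mem 0 (by omega)⟩ ⟨⟨k + 1, hk⟩, mem k hk⟩ := by
    intro k
    induction k with
    | zero => exact fun _ => Reachable.refl _
    | succ k ih =>
      intro hk
      refine (ih (by omega)).trans (Adj.reachable ?_)
      rw [comap_adj]
      simp [cycleGraph_adj_iff_val hn]
  rintro ⟨⟨x, hx⟩, hxT⟩
  cases x with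
  | zero => exact absurd rfl hxT
  | succ k => exact key k hx

/-- In a cycle, a nonsplit independent set has at most one vertex. -/
theorem NonsplitIndep.subsingleton (hn : 4 ≤ n) {S : Set (Fin n)}
    (hS : NonsplitIndep (cycleGraph n) S) : S.Subsingleton := by
  obtain ⟨hind, hconn⟩ := hS
  have key : ∀ a ∈ S, ∀ b ∈ S, ¬ a < b := by
    intro a ha b hb hab
    obtain ⟨c, hac, hc⟩ := cycleGraph_exists_succ hn a
    obtain ⟨d, hbd, hd⟩ := cycleGraph_exists_succ hn b
    have hcS : c ∈ Sᶜ := fun h => hind ha h hac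
    have hdS : d ∈ Sᶜ := fun h => hind hb h hbd
    have hcb : c ≠ b := fun h => hcS (h ▸ hb)
    rw [ne_eq, Fin.ext_iff] at hcb
    rw [Fin.lt_def] at hab
    have hsub : Sᶜ ⊆ {x | a.val < x.val ∧ x.val < b.val} := by
      refine subset_of_induce_connected hconn hcS (by simp only [Set.mem_ofPred_eq]; omega) ?_
      rintro x ⟨hax, hxb⟩ - y hy hxy
      have hya : y ≠ a := fun h => hy (h ▸ ha)
      have hyb : y ≠ b := fun h => hy (h ▸ hb)
      rw [ne_eq, Fin.ext_iff] at hya hyb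
      rw [cycleGraph_adj_iff_val hn] at hxy
      simp only [Set.mem_ofPred_eq]
      omega
    have := hsub hdS
    simp only [Set.mem_ofPred_eq] at this
    omega
  intro a ha b hb
  exact le_antisymm (not_lt.1 (key b hb a ha)) (not_lt.1 (key a ha b hb))

theorem NonsplitDominating.le_ncard (hn : 4 ≤ n) {S : Set (Fin n)}
    (hS : NonsplitDominating (cycleGraph n) S) : n - 2 ≤ S.ncard := by
  have h := hS.ncard_compl_le_two (cycleGraph_eq_of_adj_three hn)
  have := Set.ncard_add_ncard_compl S
  rw [Nat.card_fin] at this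
  omega

theorem MinimalNonsplitDominating.ncard_eq (hn : 4 ≤ n) {S : Set (Fin n)}
    (hS : MinimalNonsplitDominating (cycleGraph n) S) : S.ncard = n - 2 := by
  obtain ⟨hns, hmin⟩ := hS
  have hle := hns.le_ncard hn
  have hcard := Set.ncard_add_ncard_compl S
  rw [Nat.card_fin] at hcard
  obtain ⟨⟨t, ht⟩⟩ := hns.2.nonempty
  have hpos : 0 < Sᶜ.ncard := (Set.ncard_pos).2 ⟨t, ht⟩
  by_contra hne
  obtain ⟨v, hv⟩ := Set.ncard_eq_one.1 (show Sᶜ.ncard = 1 by omega)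
  have memS : ∀ x, x ≠ v → x ∈ S := by
    intro x hx
    by_contra h
    have : x ∈ Sᶜ := h
    rw [hv] at this
    exact hx this
  obtain ⟨u, hvu, huv⟩ := cycleGraph_exists_adj_ne hn v v
  rcases hmin u (memS u huv) with ⟨w, hw, hpriv⟩ | h
  · by_cases hwu : w = u
    · subst hwu
      obtain ⟨x, hx, hxv⟩ := cycleGraph_exists_adj_ne hn w v
      exact hpriv (Or.inr ⟨x, ⟨memS x hxv, hx.ne'⟩, hx.symm⟩)
    · by_cases hwv : w = v
      · subst hwv
        obtain ⟨x, hx, hxu⟩ := cycleGraph_exists_adj_ne hn w u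
        exact hpriv (Or.inr ⟨x, ⟨memS x hx.ne', hxu⟩, hx.symm⟩)
      · exact hpriv (Or.inl ⟨memS w hwv, hwu⟩)
  · rw [hv, Set.singleton_union] at h
    rcases h with h | h
    · exact h (induce_pair_connected_of_adj hvu)
    · rw [Set.ncard_pair hvu.ne] at h
      omega

/-- The complement of the edge `{0, 1}` is a minimal nonsplit dominating set of a cycle. -/
theorem minimalNonsplitDominating_compl_edge (hn : 4 ≤ n) :
    MinimalNonsplitDominating (cycleGraph n)
      ({⟨0, by omega⟩, ⟨1, by omega⟩} : Set (Fin n))ᶜ := by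
  have adj := cycleGraph_adj_iff_val hn
  refine ⟨⟨?_, ?_⟩, ?_⟩
  · intro v hv
    simp only [Set.mem_compl_iff, Set.mem_insert_iff, Set.mem_singleton_iff, not_not] at hv
    rcases hv with rfl | rfl
    · exact ⟨⟨n - 1, by omega⟩, by simp; omega, by rw [adj]; simp; omega⟩
    · exact ⟨⟨2, by omega⟩, by simp, by rw [adj]; simp⟩
  · rw [compl_compl]
    exact induce_pair_connected_of_adj (by rw [adj]; simp)
  · intro u hu
    simp only [Set.mem_compl_iff, Set.mem_insert_iff, Set.mem_singleton_iff, Fin.ext_iff] at hu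
    by_cases h2 : u.val = 2
    · refine Or.inl ⟨⟨1, by omega⟩, Or.inr (by rw [adj]; simp; omega), ?_⟩
      rintro (h | ⟨x, hx, hxa⟩)
      · simp at h
      · rw [adj] at hxa
        simp [Fin.ext_iff] at hx hxa
        omega
    by_cases hlast : u.val + 1 = n
    · refine Or.inl ⟨⟨0, by omega⟩, Or.inr (by rw [adj]; simp; omega), ?_⟩
      rintro (h | ⟨x, hx, hxa⟩)
      · simp at h
      · rw [adj] at hxa
        simp [Fin.ext_iff] at hx hxa
        omega
    refine Or.inr (Or.inl fun hconn => ?_)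
    rw [compl_compl] at hconn
    have hsub := subset_of_induce_connected (A := {u}) hconn (t := u) (by simp) rfl (by
      rintro x rfl - y hy hxy
      rw [adj] at hxy
      simp only [Set.union_singleton, Set.mem_insert_iff, Set.mem_singleton_iff,
        Fin.ext_iff] at hy ⊢
      omega)
    have h0 := @hsub ⟨0, by omega⟩ (by simp)
    rw [Set.mem_singleton_iff, Fin.ext_iff] at h0
    simp only at h0
    omega

theorem nonsplitIndep_zero (hn : 4 ≤ n) :
    NonsplitIndep (cycleGraph n) ({⟨0, by omega⟩} : Set (Fin n)) := by
  refine ⟨?_, cycleGraph_induce_compl_zero_connected hn⟩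
  rintro u rfl v rfl
  exact (cycleGraph n).irrefl

theorem maximalNonsplitIndep_zero (hn : 4 ≤ n) :
    MaximalNonsplitIndep (cycleGraph n) ({⟨0, by omega⟩} : Set (Fin n)) := by
  refine ⟨nonsplitIndep_zero hn, fun v hv => ?_⟩
  by_contra! h
  unfold DisconnOrK1 at h
  push Not at h
  exact hv (NonsplitIndep.subsingleton hn ⟨h.1, h.2.1⟩ (by simp) (by simp))

theorem MaximalNonsplitIndep.ncard_eq_one (hn : 4 ≤ n) {S : Set (Fin n)}
    (hS : MaximalNonsplitIndep (cycleGraph n) S) : S.ncard = 1 := by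
  rcases (hS.1.subsingleton hn).eq_empty_or_singleton with rfl | ⟨a, rfl⟩
  · rcases hS.2 ⟨0, by omega⟩ (Set.notMem_empty _) with h | h | h
    · rw [Set.empty_union] at h
      exact absurd (nonsplitIndep_zero hn).1 h
    · rw [Set.empty_union] at h
      exact absurd (nonsplitIndep_zero hn).2 h
    · rw [Set.empty_union] at h
      have := Set.ncard_add_ncard_compl ({⟨0, by omega⟩} : Set (Fin n))
      rw [h, Nat.card_fin, Set.ncard_singleton] at this
      omega
  · exact Set.ncard_singleton a

end Cycle

/-- For the cycle `Cₙ`, `n ≥ 4`: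
`γₙₛ(Cₙ) = Γₙₛ(Cₙ) = n - 2` and `iₙₛ(Cₙ) = βₙₛ(Cₙ) = 1`. -/
theorem cycle_nonsplit_params (n : ℕ) (hn : 4 ≤ n) :
    gammaNS (SimpleGraph.cycleGraph n) = n - 2 ∧
    GammaNS (SimpleGraph.cycleGraph n) = n - 2 ∧
    iNS (SimpleGraph.cycleGraph n) = 1 ∧
    betaNS (SimpleGraph.cycleGraph n) = 1 := by
  have hmin := minimalNonsplitDominating_compl_edge hn
  have hmax := maximalNonsplitIndep_zero hn
  refine ⟨IsLeast.csInf_eq ⟨⟨_, hmin.1, hmin.ncard_eq hn⟩, ?_⟩,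
    IsGreatest.csSup_eq ⟨⟨_, hmin, hmin.ncard_eq hn⟩, ?_⟩,
    IsLeast.csInf_eq ⟨⟨_, hmax, hmax.ncard_eq_one hn⟩, ?_⟩,
    IsGreatest.csSup_eq ⟨⟨_, hmax, hmax.ncard_eq_one hn⟩, ?_⟩⟩
  · rintro _ ⟨S, hS, rfl⟩
    exact hS.le_ncard hn
  · rintro _ ⟨S, hS, rfl⟩
    exact (hS.ncard_eq hn).le
  · rintro _ ⟨S, hS, rfl⟩
    exact (hS.ncard_eq_one hn).ge
  · rintro _ ⟨S, hS, rfl⟩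
    exact (hS.ncard_eq_one hn).le

end SplitDomination
end

section
/- For the complete bipartite graph K_{m,n} with 2 ≤ m ≤ n: γ_ns(K_{m,n}) = Γ_ns(K_{m,n}) = 2, i_ns(K_{m,n}) = m − 1, β_ns(K_{m,n}) = n − 1, and ir_ns(K_{m,n}) = 2. -/
open SimpleGraph

namespace SplitDomination

variable {V : Type*}

section CompleteBipartite

variable {α β : Type*} {S : Set (α ⊕ β)}

local notation "K" => completeBipartiteGraph α β

theorem induce_completeBipartiteGraph_connected_iff :
    ((K).induce S).Connected ↔
      ((∃ a, Sum.inl a ∈ S) ∧ ∃ b, Sum.inr b ∈ S) ∨ ∃ x, S = {x} := by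
  constructor
  · intro h
    obtain ⟨x, hx⟩ := h.nonempty
    by_cases hS : S.Subsingleton
    · exact .inr ⟨x, hS.eq_singleton_of_mem hx⟩
    · rw [Set.not_subsingleton_iff] at hS
      have : Nontrivial S := hS.coe_sort
      obtain ⟨⟨y, hy⟩, hxy⟩ := h.preconnected.exists_adj_of_nontrivial ⟨x, hx⟩
      left
      rcases x with a | b <;> rcases y with c | d <;> simp at hxy
      · exact ⟨⟨a, hx⟩, d, hy⟩
      · exact ⟨⟨c, hy⟩, b, hx⟩
  · rintro (⟨⟨a, ha⟩, b, hb⟩ | ⟨x, rfl⟩)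
    · have hab : ((K).induce S).Adj ⟨.inl a, ha⟩ ⟨.inr b, hb⟩ := by simp
      refine connected_iff_exists_forall_reachable _ |>.2 ⟨⟨.inl a, ha⟩, ?_⟩
      rintro ⟨c | d, h⟩
      · have hcb : ((K).induce S).Adj ⟨.inr b, hb⟩ ⟨.inl c, h⟩ := by simp
        exact hab.reachable.trans hcb.reachable
      · have had : ((K).induce S).Adj ⟨.inl a, ha⟩ ⟨.inr d, h⟩ := by simp
        exact had.reachable
    · exact connected_iff_exists_forall_reachable _ |>.2
        ⟨⟨x, rfl⟩, fun y => by rw [Subsingleton.elim y ⟨x, rfl⟩]⟩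

theorem disconnOrK1_completeBipartiteGraph_iff :
    DisconnOrK1 (K) S ↔ ¬ ((∃ a, Sum.inl a ∈ S) ∧ ∃ b, Sum.inr b ∈ S) := by
  rw [DisconnOrK1, induce_completeBipartiteGraph_connected_iff, Set.ncard_eq_one]
  constructor
  · rintro (h | ⟨x, rfl⟩)
    · tauto
    · rintro ⟨⟨a, ha⟩, b, hb⟩
      simp only [Set.mem_singleton_iff] at ha hb
      simp [← ha] at hb
  · tauto

theorem not_hasPrivateNbr_inl {a a' : α} {b : β} (ha : Sum.inl a' ∈ S) (hb : Sum.inr b ∈ S)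
    (h : a' ≠ a) : ¬ HasPrivateNbr (K) S (Sum.inl a) := by
  rintro ⟨w, hw, hn⟩
  apply hn
  rcases w with c | d
  · exact .inr ⟨.inr b, ⟨hb, by simp⟩, by simp⟩
  · exact .inr ⟨.inl a', ⟨ha, by simpa using h⟩, by simp⟩

theorem not_hasPrivateNbr_inr {a : α} {b b' : β} (ha : Sum.inl a ∈ S) (hb : Sum.inr b' ∈ S)
    (h : b' ≠ b) : ¬ HasPrivateNbr (K) S (Sum.inr b) := by
  rintro ⟨w, hw, hn⟩
  apply hn
  rcases w with c | d
  · exact .inr ⟨.inr b', ⟨hb, by simpa using h⟩, by simp⟩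
  · exact .inr ⟨.inl a, ⟨ha, by simp⟩, by simp⟩

theorem hasPrivateNbr_inl_pair [Nontrivial β] (a : α) (b : β) :
    HasPrivateNbr (K) {Sum.inl a, Sum.inr b} (Sum.inl a) := by
  obtain ⟨d, hd⟩ := exists_ne b
  refine ⟨.inr d, by simp, ?_⟩
  simp [ClosedNbhd, hd]

theorem hasPrivateNbr_inr_pair [Nontrivial α] (a : α) (b : β) :
    HasPrivateNbr (K) {Sum.inl a, Sum.inr b} (Sum.inr b) := by
  obtain ⟨c, hc⟩ := exists_ne a
  refine ⟨.inl c, by simp, ?_⟩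
  simp [ClosedNbhd, hc]

theorem exists_mem_compl_pair [Nontrivial α] [Nontrivial β] (a : α) (b : β) :
    (∃ c, Sum.inl c ∈ ({Sum.inl a, Sum.inr b} : Set (α ⊕ β))ᶜ) ∧
      ∃ d, Sum.inr d ∈ ({Sum.inl a, Sum.inr b} : Set (α ⊕ β))ᶜ := by
  simpa using And.intro (exists_ne a) (exists_ne b)

theorem minimalNonsplitDominating_pair [Nontrivial α] [Nontrivial β] (a : α) (b : β) :
    MinimalNonsplitDominating (K) {Sum.inl a, Sum.inr b} := by
  refine ⟨⟨?_, induce_completeBipartiteGraph_connected_iff.2 (.inl (exists_mem_compl_pair a b))⟩,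
    ?_⟩
  · rintro (c | d) -
    · exact ⟨.inr b, by simp, by simp⟩
    · exact ⟨.inl a, by simp, by simp⟩
  · rintro u (rfl | rfl)
    · exact .inl (hasPrivateNbr_inl_pair a b)
    · exact .inl (hasPrivateNbr_inr_pair a b)

theorem maximalNonsplitIrred_pair [Nontrivial α] [Nontrivial β] (a : α) (b : β) :
    MaximalNonsplitIrred (K) {Sum.inl a, Sum.inr b} := by
  refine ⟨⟨?_, induce_completeBipartiteGraph_connected_iff.2 (.inl (exists_mem_compl_pair a b))⟩,
    ?_⟩
  · rintro u (rfl | rfl)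
    · exact hasPrivateNbr_inl_pair a b
    · exact hasPrivateNbr_inr_pair a b
  · rintro (c | d) h
    · exact .inl (not_hasPrivateNbr_inl (a' := a) (b := b) (by simp) (by simp)
        (by rintro rfl; simp at h))
    · exact .inl (not_hasPrivateNbr_inr (a := a) (b' := b) (by simp) (by simp)
        (by rintro rfl; simp at h))

theorem NonsplitDominating.exists_mem [Nontrivial α] [Nontrivial β]
    (h : NonsplitDominating (K) S) : (∃ a, Sum.inl a ∈ S) ∧ ∃ b, Sum.inr b ∈ S := by
  obtain ⟨hd, hc⟩ := h
  rw [induce_completeBipartiteGraph_connected_iff] at hc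
  constructor
  · by_contra! hS
    have hr (b : β) : Sum.inr b ∈ S := by
      by_contra hb
      obtain ⟨a | c, hu, hadj⟩ := hd _ hb
      · exact hS a hu
      · simp at hadj
    obtain ⟨-, b, hb⟩ | ⟨x, hx⟩ := hc
    · exact hb (hr b)
    · obtain ⟨a, a', haa⟩ := exists_pair_ne α
      have h₁ : Sum.inl a ∈ Sᶜ := hS a
      have h₂ : Sum.inl a' ∈ Sᶜ := hS a'
      rw [hx, Set.mem_singleton_iff] at h₁ h₂
      exact haa (Sum.inl_injective (h₁.trans h₂.symm))
  · by_contra! hS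
    have hl (a : α) : Sum.inl a ∈ S := by
      by_contra ha
      obtain ⟨c | b, hu, hadj⟩ := hd _ ha
      · simp at hadj
      · exact hS b hu
    obtain ⟨⟨a, ha⟩, -⟩ | ⟨x, hx⟩ := hc
    · exact ha (hl a)
    · obtain ⟨b, b', hbb⟩ := exists_pair_ne β
      have h₁ : Sum.inr b ∈ Sᶜ := hS b
      have h₂ : Sum.inr b' ∈ Sᶜ := hS b'
      rw [hx, Set.mem_singleton_iff] at h₁ h₂
      exact hbb (Sum.inr_injective (h₁.trans h₂.symm))

theorem MinimalNonsplitDominating.exists_eq_pair [Nontrivial α] [Nontrivial β]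
    (h : MinimalNonsplitDominating (K) S) : ∃ a b, S = {Sum.inl a, Sum.inr b} := by
  obtain ⟨hd, hm⟩ := h
  obtain ⟨⟨a, ha⟩, b, hb⟩ := hd.exists_mem
  obtain ⟨x, hx⟩ := hd.2.nonempty
  simp only [disconnOrK1_completeBipartiteGraph_iff] at hm
  have hl (c c') (hc : Sum.inl c ∈ S) (hc' : Sum.inl c' ∈ S) (hne : c' ≠ c) (d : β) :
      Sum.inr d ∈ S := by
    by_contra hd
    exact ((hm _ hc).resolve_left (not_hasPrivateNbr_inl hc' hb hne))
      ⟨⟨c, by simp⟩, d, by simp [hd]⟩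
  have hr (d d') (hd : Sum.inr d ∈ S) (hd' : Sum.inr d' ∈ S) (hne : d' ≠ d) (c : α) :
      Sum.inl c ∈ S := by
    by_contra hc
    exact ((hm _ hd).resolve_left (not_hasPrivateNbr_inr ha hd' hne))
      ⟨⟨c, by simp [hc]⟩, d, by simp⟩
  have hl' (c) (hc : Sum.inl c ∈ S) : c = a := by
    by_contra hne
    have hR := hl a c ha hc hne
    obtain ⟨d, d', hdd⟩ := exists_pair_ne β
    have hL := hr d' d (hR _) (hR _) hdd
    rcases x with x | x
    · exact hx (hL x)
    · exact hx (hR x)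
  have hr' (d) (hd : Sum.inr d ∈ S) : d = b := by
    by_contra hne
    have hL := hr b d hb hd hne
    obtain ⟨c, c', hcc⟩ := exists_pair_ne α
    exact hcc ((hl' c (hL c)).trans (hl' c' (hL c')).symm)
  refine ⟨a, b, ?_⟩
  ext (c | d)
  · simpa using ⟨hl' c, by rintro rfl; exact ha⟩
  · simpa using ⟨hr' d, by rintro rfl; exact hb⟩

theorem maximalNonsplitIndep_iff [Nontrivial α] [Nontrivial β] :
    MaximalNonsplitIndep (K) S ↔
      (∃ a, S = Sum.inl '' {a}ᶜ) ∨ ∃ b, S = Sum.inr '' {b}ᶜ := by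
  simp only [MaximalNonsplitIndep, NonsplitIndep, disconnOrK1_completeBipartiteGraph_iff,
    induce_completeBipartiteGraph_connected_iff]
  constructor
  · rintro ⟨⟨hi, hc⟩, hm⟩
    have hne : S.Nonempty := by
      by_contra! h
      subst h
      obtain ⟨a, a', haa⟩ := exists_pair_ne α
      obtain ⟨b⟩ : Nonempty β := inferInstance
      refine (hm (.inl a) (by simp)).elim (fun h => h ?_) (fun h => h ⟨⟨a', ?_⟩, b, ?_⟩)
      · simp [Indep]
      · simpa using haa.symm
      · simp
    obtain ⟨a | b, hx⟩ := hne
    · left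
      have hR (b : β) : Sum.inr b ∉ S := fun hb => hi hx hb (by simp)
      have hL : ∃ c, Sum.inl c ∉ S := by
        by_contra! hL
        obtain ⟨⟨c, h⟩, -⟩ | ⟨y, hy⟩ := hc
        · exact h (hL c)
        · obtain ⟨b, b', hbb⟩ := exists_pair_ne β
          have h₁ : Sum.inr b ∈ Sᶜ := hR b
          have h₂ : Sum.inr b' ∈ Sᶜ := hR b'
          rw [hy, Set.mem_singleton_iff] at h₁ h₂
          exact hbb (Sum.inr_injective (h₁.trans h₂.symm))
      obtain ⟨c, h⟩ := hL
      refine ⟨c, ?_⟩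
      ext (e | b)
      · simp only [Set.mem_image, Set.mem_compl_iff, Set.mem_singleton_iff, Sum.inl.injEq,
          exists_eq_right]
        refine ⟨by rintro he rfl; exact h he, fun hec => ?_⟩
        by_contra he
        obtain ⟨b⟩ : Nonempty β := inferInstance
        refine (hm _ h).elim (fun h => h ?_) (fun h => h ⟨⟨e, ?_⟩, b, ?_⟩)
        · rintro (u | u) hu (v | v) hv <;> simp [hR] at hu hv ⊢
        · simp [he, hec]
        · simp [hR]
      · simp [hR]
    · right
      have hL (a : α) : Sum.inl a ∉ S := fun ha => hi hx ha (by simp)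
      have hR : ∃ c, Sum.inr c ∉ S := by
        by_contra! hR
        obtain ⟨-, c, h⟩ | ⟨y, hy⟩ := hc
        · exact h (hR c)
        · obtain ⟨a, a', haa⟩ := exists_pair_ne α
          have h₁ : Sum.inl a ∈ Sᶜ := hL a
          have h₂ : Sum.inl a' ∈ Sᶜ := hL a'
          rw [hy, Set.mem_singleton_iff] at h₁ h₂
          exact haa (Sum.inl_injective (h₁.trans h₂.symm))
      obtain ⟨c, h⟩ := hR
      refine ⟨c, ?_⟩
      ext (a | e)
      · simp [hL]
      · simp only [Set.mem_image, Set.mem_compl_iff, Set.mem_singleton_iff, Sum.inr.injEq,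
          exists_eq_right]
        refine ⟨by rintro he rfl; exact h he, fun hec => ?_⟩
        by_contra he
        obtain ⟨a⟩ : Nonempty α := inferInstance
        refine (hm _ h).elim (fun h => h ?_) (fun h => h ⟨⟨a, ?_⟩, e, ?_⟩)
        · rintro (u | u) hu (v | v) hv <;> simp [hL] at hu hv ⊢
        · simp [hL]
        · simp [he, hec]
  · rintro (⟨a, rfl⟩ | ⟨b, rfl⟩)
    · obtain ⟨a', ha'⟩ := exists_ne a
      obtain ⟨b⟩ : Nonempty β := inferInstance
      refine ⟨⟨?_, .inl ⟨⟨a, by simp⟩, b, by simp⟩⟩, ?_⟩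
      · rintro _ ⟨u, -, rfl⟩ _ ⟨v, -, rfl⟩
        simp
      · rintro (c | d) h
        · obtain rfl : c = a := by simpa using h
          right
          rintro ⟨⟨e, he⟩, -⟩
          simp at he
        · exact .inl fun hi => @hi (.inl a') (by simp [ha']) (.inr d) (by simp) (by simp)
    · obtain ⟨b', hb'⟩ := exists_ne b
      obtain ⟨a⟩ : Nonempty α := inferInstance
      refine ⟨⟨?_, .inl ⟨⟨a, by simp⟩, b, by simp⟩⟩, ?_⟩
      · rintro _ ⟨u, -, rfl⟩ _ ⟨v, -, rfl⟩
        simp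
      · rintro (c | d) h
        · exact .inl fun hi => @hi (.inl c) (by simp) (.inr b') (by simp [hb']) (by simp)
        · obtain rfl : d = b := by simpa using h
          right
          rintro ⟨-, e, he⟩
          simp at he

theorem MaximalNonsplitIrred.two_le_ncard [Finite α] [Finite β] [Nontrivial α] [Nontrivial β]
    (h : MaximalNonsplitIrred (K) S) : 2 ≤ S.ncard := by
  obtain ⟨-, hm⟩ := h
  simp only [disconnOrK1_completeBipartiteGraph_iff] at hm
  by_contra! hlt
  obtain h0 | h1 : S.ncard = 0 ∨ S.ncard = 1 := by omega
  · obtain rfl := (Set.ncard_eq_zero).1 h0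
    obtain ⟨a, a', haa⟩ := exists_pair_ne α
    obtain ⟨b⟩ : Nonempty β := inferInstance
    refine (hm (.inl a) (by simp)).elim (fun h => h ⟨.inl a, by simp, ?_⟩)
      (fun h => h ⟨⟨a', ?_⟩, b, ?_⟩)
    · simp [ClosedNbhd]
    · simpa using haa.symm
    · simp
  · obtain ⟨a | b, rfl⟩ := Set.ncard_eq_one.1 h1
    · obtain ⟨b⟩ : Nonempty β := inferInstance
      have := hm (.inr b) (by simp)
      rw [Set.singleton_union] at this
      exact this.elim (fun h => h (hasPrivateNbr_inr_pair a b))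
        (fun h => h (exists_mem_compl_pair a b))
    · obtain ⟨a⟩ : Nonempty α := inferInstance
      have := hm (.inl a) (by simp)
      rw [Set.union_singleton] at this
      exact this.elim (fun h => h (hasPrivateNbr_inl_pair a b))
        (fun h => h (exists_mem_compl_pair a b))

theorem ncard_pair_inl_inr (a : α) (b : β) :
    ({Sum.inl a, Sum.inr b} : Set (α ⊕ β)).ncard = 2 :=
  Set.ncard_pair (by simp)

theorem NonsplitDominating.two_le_ncard [Finite α] [Finite β] [Nontrivial α] [Nontrivial β]
    (h : NonsplitDominating (K) S) : 2 ≤ S.ncard := by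
  obtain ⟨⟨a, ha⟩, b, hb⟩ := h.exists_mem
  rw [← ncard_pair_inl_inr a b]
  exact Set.ncard_le_ncard (Set.pair_subset ha hb) S.toFinite

theorem setOf_ncard_maximalNonsplitIndep [Finite α] [Finite β] [Nontrivial α] [Nontrivial β] :
    {k | ∃ S : Set (α ⊕ β), MaximalNonsplitIndep (K) S ∧ S.ncard = k} =
      {Nat.card α - 1, Nat.card β - 1} := by
  have hα (a : α) : (Sum.inl '' {a}ᶜ : Set (α ⊕ β)).ncard = Nat.card α - 1 := by
    rw [Set.ncard_image_of_injective _ Sum.inl_injective, Set.ncard_compl, Set.ncard_singleton]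
  have hβ (b : β) : (Sum.inr '' {b}ᶜ : Set (α ⊕ β)).ncard = Nat.card β - 1 := by
    rw [Set.ncard_image_of_injective _ Sum.inr_injective, Set.ncard_compl, Set.ncard_singleton]
  obtain ⟨a⟩ : Nonempty α := inferInstance
  obtain ⟨b⟩ : Nonempty β := inferInstance
  ext k
  simp only [maximalNonsplitIndep_iff, Set.mem_ofPred_eq, Set.mem_insert_iff,
    Set.mem_singleton_iff]
  constructor
  · rintro ⟨_, ⟨a, rfl⟩ | ⟨b, rfl⟩, rfl⟩
    · exact .inl (hα a)
    · exact .inr (hβ b)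
  · rintro (rfl | rfl)
    · exact ⟨_, .inl ⟨a, rfl⟩, hα a⟩
    · exact ⟨_, .inr ⟨b, rfl⟩, hβ b⟩

end CompleteBipartite

/-- For `K_{m,n}` with `2 ≤ m ≤ n`:
`γₙₛ = Γₙₛ = 2`, `iₙₛ = m - 1`, `βₙₛ = n - 1`, `irₙₛ = 2`. -/
theorem completeBipartite_nonsplit_params (m n : ℕ)
    (hm : 2 ≤ m) (hmn : m ≤ n) :
    gammaNS (completeBipartiteGraph (Fin m) (Fin n)) = 2 ∧
    GammaNS (completeBipartiteGraph (Fin m) (Fin n)) = 2 ∧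
    iNS (completeBipartiteGraph (Fin m) (Fin n)) = m - 1 ∧
    betaNS (completeBipartiteGraph (Fin m) (Fin n)) = n - 1 ∧
    irNS (completeBipartiteGraph (Fin m) (Fin n)) = 2 := by
  have : Nontrivial (Fin m) := Fin.nontrivial_iff_two_le.2 hm
  have : Nontrivial (Fin n) := Fin.nontrivial_iff_two_le.2 (hm.trans hmn)
  obtain ⟨a⟩ : Nonempty (Fin m) := inferInstance
  obtain ⟨b⟩ : Nonempty (Fin n) := inferInstance
  have hmin := minimalNonsplitDominating_pair a b
  have hcard := ncard_pair_inl_inr a b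
  refine ⟨?_, ?_, ?_, ?_, ?_⟩
  · refine IsLeast.csInf_eq ⟨⟨_, hmin.1, hcard⟩, ?_⟩
    rintro _ ⟨S, hS, rfl⟩
    exact hS.two_le_ncard
  · refine IsGreatest.csSup_eq ⟨⟨_, hmin, hcard⟩, ?_⟩
    rintro _ ⟨S, hS, rfl⟩
    obtain ⟨c, d, rfl⟩ := hS.exists_eq_pair
    exact (ncard_pair_inl_inr c d).le
  · rw [iNS, setOf_ncard_maximalNonsplitIndep, csInf_pair]
    simpa using by omega
  · rw [betaNS, setOf_ncard_maximalNonsplitIndep, csSup_pair]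
    simpa using by omega
  · refine IsLeast.csInf_eq ⟨⟨_, maximalNonsplitIrred_pair a b, hcard⟩, ?_⟩
    rintro _ ⟨S, hS, rfl⟩
    exact hS.two_le_ncard

end SplitDomination
end
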